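/- arXiv:2605.25787 — 7 statements merged into one kernel-verified Lean document; each statement's English description precedes it below -/
import Mathlib

section
/- Let r, p, P, B, C be real numbers with 0 < r < p < P and B, C > 0, and define h : (0,∞) → ℝ by h(t) = t^p/p − B·t^r − C·t^P. Assume there exists t > 0 with h(t) > 0. Then: (i) there exist real numbers 0 < R₀ < R₁ with h(R₀) = h(R₁) = 0, and for t > 0 one has h(t) > 0 if and only if R₀ < t < R₁ (so h(t) < 0 for t ∈ (0,R₀) ∪ (R₁,∞)); (ii) h has exactly two critical points on (0,∞): a point t_min ∈ (0,R₀) which is a strict local minimum with h(t_min) < 0, and a point t_max ∈ (R₀,R₁) which is the global maximum of h on (0,∞) with h(t_max) > 0. -/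
lemma aux_k (a b c k : ℝ) (ha : 0 < a) (hb : 0 < b) (hc : 0 < c) (hk : 1 < k)
    (hpos : ∃ s : ℝ, 0 < s ∧ 0 < a * s - b - c * s ^ k) :
    ∃ s₀ s₁ : ℝ, 0 < s₀ ∧ s₀ < s₁ ∧ a * s₀ - b - c * s₀ ^ k = 0 ∧ a * s₁ - b - c * s₁ ^ k = 0 ∧
      (∀ s, 0 < s → s < s₀ → a * s - b - c * s ^ k < 0) ∧
      (∀ s, s₀ < s → s < s₁ → 0 < a * s - b - c * s ^ k) ∧
      (∀ s, s₁ < s → a * s - b - c * s ^ k < 0) := by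
  obtain ⟨m, hm, hφm⟩ := hpos
  obtain ⟨φ, hφ⟩ : ∃ φ : ℝ → ℝ, ∀ s, a * s - b - c * s ^ k = φ s := ⟨_, fun _ => rfl⟩
  have key : ∀ l x y z, 0 ≤ x → x < y → y < z → l ≤ φ x → l ≤ φ z → l < φ y := by
    intro l x y z hx hxy hyz hlx hlz
    have hxz : x < z := hxy.trans hyz
    have hzx : z - x ≠ 0 := (sub_pos.2 hxz).ne'
    have h1 : 0 < (z - y) / (z - x) := div_pos (by linarith) (by linarith)
    have h2 : 0 < (y - x) / (z - x) := div_pos (by linarith) (by linarith)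
    have h3 : (z - y) / (z - x) + (y - x) / (z - x) = 1 := by
      field_simp; ring
    have hc1 := (strictConvexOn_rpow hk).2 (show x ∈ Set.Ici (0 : ℝ) from hx)
      (show z ∈ Set.Ici (0 : ℝ) from hx.trans hxz.le) hxz.ne h1 h2 h3
    simp only [smul_eq_mul] at hc1
    have e : (z - y) / (z - x) * x + (y - x) / (z - x) * z = y := by field_simp; ring
    rw [e] at hc1
    generalize (z - y) / (z - x) = u at *
    generalize (y - x) / (z - x) = v at *
    rw [← hφ] at hlx hlz ⊢
    have g1 := mul_le_mul_of_nonneg_left hlx h1.le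
    have g2 := mul_le_mul_of_nonneg_left hlz h2.le
    have g3 := mul_lt_mul_of_pos_left hc1 hc
    have hv : v = 1 - u := by linarith
    subst hv
    subst e
    nlinarith
  have hcont : Continuous φ := by
    have : φ = fun s => a * s - b - c * s ^ k := funext fun s => (hφ s).symm
    rw [this]
    have := Real.continuous_rpow_const (by linarith : 0 ≤ k)
    fun_prop
  have h0 : φ 0 = -b := by
    rw [← hφ, Real.zero_rpow (zero_lt_one.trans hk).ne']; ring
  obtain ⟨S, hS, hφS⟩ : ∃ S, 0 < S ∧ φ S = -b := by
    refine ⟨(a / c) ^ (1 / (k - 1)), by positivity, ?_⟩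
    have hS : 0 < (a / c) ^ (1 / (k - 1)) := by positivity
    have e : ((a / c) ^ (1 / (k - 1))) ^ (k - 1) = a / c := by
      rw [← Real.rpow_mul (by positivity), one_div_mul_cancel (sub_pos.2 hk).ne', Real.rpow_one]
    generalize (a / c) ^ (1 / (k - 1)) = S at *
    rw [Real.rpow_sub_one hS.ne'] at e
    rw [← hφ]
    field_simp at e
    linarith
  simp only [hφ] at *
  have hmS : m < S := by
    by_contra hcon
    rcases (not_lt.1 hcon).lt_or_eq with h | h
    · have := key (-b) 0 S m le_rfl hS h h0.ge (by linarith)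
      linarith
    · rw [h] at hφS; linarith
  obtain ⟨s₀, ⟨hs0, hs0m⟩, hz0⟩ := intermediate_value_Ioo hm.le hcont.continuousOn
    (show (0 : ℝ) ∈ Set.Ioo (φ 0) (φ m) from ⟨by linarith, hφm⟩)
  obtain ⟨s₁, ⟨hs1, hs1S⟩, hz1⟩ := intermediate_value_Ioo' hmS.le hcont.continuousOn
    (show (0 : ℝ) ∈ Set.Ioo (φ S) (φ m) from ⟨by linarith, hφm⟩)
  refine ⟨s₀, s₁, hs0, hs0m.trans hs1, hz0, hz1, ?_, ?_, ?_⟩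
  · intro s h1 h2
    by_contra hcon
    have := key 0 s s₀ m h1.le h2 hs0m (not_lt.1 hcon) hφm.le
    linarith
  · intro s h1 h2
    exact key 0 s₀ s s₁ hs0.le h1 h2 hz0.ge hz1.ge
  · intro s h1
    by_contra hcon
    have := key 0 m s₁ s hm.le hs1 h1 hφm.le (not_lt.1 hcon)
    linarith

lemma aux_ab (a b c α β : ℝ) (ha : 0 < a) (hb : 0 < b) (hc : 0 < c) (hα : 0 < α) (hαβ : α < β)
    (hpos : ∃ s : ℝ, 0 < s ∧ 0 < a * s ^ α - b - c * s ^ β) :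
    ∃ s₀ s₁ : ℝ, 0 < s₀ ∧ s₀ < s₁ ∧ a * s₀ ^ α - b - c * s₀ ^ β = 0 ∧
      a * s₁ ^ α - b - c * s₁ ^ β = 0 ∧
      (∀ s, 0 < s → s < s₀ → a * s ^ α - b - c * s ^ β < 0) ∧
      (∀ s, s₀ < s → s < s₁ → 0 < a * s ^ α - b - c * s ^ β) ∧
      (∀ s, s₁ < s → a * s ^ α - b - c * s ^ β < 0) := by
  have e : ∀ s : ℝ, 0 < s → s ^ β = (s ^ α) ^ (β / α) := by
    intro s hs
    rw [← Real.rpow_mul hs.le, mul_div_cancel₀ _ hα.ne']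
  obtain ⟨m, hm, hφm⟩ := hpos
  rw [e m hm] at hφm
  obtain ⟨s₀, s₁, h0, h01, z0, z1, H1, H2, H3⟩ := aux_k a b c (β / α) ha hb hc
    ((one_lt_div hα).2 hαβ) ⟨m ^ α, by positivity, hφm⟩
  have h1 := h0.trans h01
  have i : ∀ s : ℝ, 0 < s → (s ^ (1 / α)) ^ α = s := by
    intro s hs
    rw [← Real.rpow_mul hs.le, one_div_mul_cancel hα.ne', Real.rpow_one]
  have hα' : 0 < 1 / α := by positivity
  obtain ⟨u, hu, rfl⟩ : ∃ u : ℝ, 0 < u ∧ u ^ α = s₀ := ⟨s₀ ^ (1 / α), by positivity, i s₀ h0⟩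
  obtain ⟨v, hv, rfl⟩ : ∃ v : ℝ, 0 < v ∧ v ^ α = s₁ := ⟨s₁ ^ (1 / α), by positivity, i s₁ h1⟩
  refine ⟨u, v, hu, (Real.rpow_lt_rpow_iff hu.le hv.le hα).1 h01, ?_, ?_, ?_, ?_, ?_⟩
  · rw [e u hu]; exact z0
  · rw [e v hv]; exact z1
  · intro s hs hsu
    rw [e s hs]
    exact H1 _ (by positivity) (Real.rpow_lt_rpow hs.le hsu hα)
  · intro s hsu hsv
    have hs := hu.trans hsu
    rw [e s hs]
    exact H2 _ (Real.rpow_lt_rpow hu.le hsu hα) (Real.rpow_lt_rpow hs.le hsv hα)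
  · intro s hsv
    have hs := hv.trans hsv
    rw [e s hs]
    exact H3 _ (Real.rpow_lt_rpow hv.le hsv hα)

/-- Lemma 2.2 (abstract form): if `h(t) = t^p/p - B·t^r - C·t^P` with `0 < r < p < P`,
`B, C > 0`, is positive somewhere on `(0,∞)`, then there are `0 < R₀ < R₁` with
`h(R₀) = h(R₁) = 0`, `h > 0` exactly on `(R₀, R₁)`, and `h` has exactly two critical points
on `(0,∞)`: a strict local minimum `t_min ∈ (0, R₀)` at negative level, and a global
maximum `t_max ∈ (R₀, R₁)` at positive level. -/
theorem stmt3 (r p P B C : ℝ) (hr : 0 < r) (hrp : r < p) (hpP : p < P)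
    (hB : 0 < B) (hC : 0 < C)
    (hpos : ∃ t : ℝ, 0 < t ∧ 0 < t ^ p / p - B * t ^ r - C * t ^ P) :
    let h : ℝ → ℝ := fun t => t ^ p / p - B * t ^ r - C * t ^ P
    ∃ R₀ R₁ : ℝ, 0 < R₀ ∧ R₀ < R₁ ∧ h R₀ = 0 ∧ h R₁ = 0 ∧
      (∀ t : ℝ, 0 < t → (0 < h t ↔ R₀ < t ∧ t < R₁)) ∧
      ∃ tmin tmax : ℝ, tmin ∈ Set.Ioo 0 R₀ ∧ tmax ∈ Set.Ioo R₀ R₁ ∧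
        deriv h tmin = 0 ∧ deriv h tmax = 0 ∧
        (∀ t : ℝ, 0 < t → deriv h t = 0 → t = tmin ∨ t = tmax) ∧
        (∃ ε > 0, ∀ t : ℝ, |t - tmin| < ε → t ≠ tmin → h tmin < h t) ∧
        h tmin < 0 ∧
        (∀ t : ℝ, 0 < t → t ≠ tmax → h t < h tmax) ∧
        0 < h tmax := by
  intro h
  have hp : 0 < p := hr.trans hrp
  have hP : 0 < P := hp.trans hpP
  have hfac : ∀ t : ℝ, 0 < t → h t = t ^ r * (1 / p * t ^ (p - r) - B - C * t ^ (P - r)) := by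
    intro t ht
    have e1 : t ^ p = t ^ r * t ^ (p - r) := by rw [← Real.rpow_add ht]; congr 1; ring
    have e2 : t ^ P = t ^ r * t ^ (P - r) := by rw [← Real.rpow_add ht]; congr 1; ring
    simp only [h]; rw [e1, e2]; ring
  have hder : ∀ t : ℝ, 0 < t →
      deriv h t = t ^ (r - 1) * (1 * t ^ (p - r) - B * r - C * P * t ^ (P - r)) := by
    intro t ht
    have d : HasDerivAt h (p * t ^ (p - 1) / p - B * (r * t ^ (r - 1)) - C * (P * t ^ (P - 1))) t :=
      (((Real.hasDerivAt_rpow_const (Or.inl ht.ne')).div_const p).sub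
        ((Real.hasDerivAt_rpow_const (Or.inl ht.ne')).const_mul B)).sub
        ((Real.hasDerivAt_rpow_const (Or.inl ht.ne')).const_mul C)
    have e1 : t ^ (p - 1) = t ^ (r - 1) * t ^ (p - r) := by
      rw [← Real.rpow_add ht]; congr 1; ring
    have e2 : t ^ (P - 1) = t ^ (r - 1) * t ^ (P - r) := by
      rw [← Real.rpow_add ht]; congr 1; ring
    rw [d.deriv, e1, e2]; field_simp
  have hcont : Continuous h := by
    have c1 := Real.continuous_rpow_const hp.le
    have c2 := Real.continuous_rpow_const hr.le
    have c3 := Real.continuous_rpow_const hP.le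
    simp only [h]
    fun_prop
  have h0 : h 0 = 0 := by
    simp only [h, Real.zero_rpow hp.ne', Real.zero_rpow hr.ne', Real.zero_rpow hP.ne']; simp
  obtain ⟨m, hm, hφm⟩ := hpos
  change 0 < h m at hφm
  obtain ⟨R₀, R₁, hR0, hR01, z0, z1, H1, H2, H3⟩ := aux_ab (1 / p) B C (p - r) (P - r)
    (by positivity) hB hC (by linarith) (by linarith)
    ⟨m, hm, by rw [hfac m hm] at hφm; exact (pos_iff_pos_of_mul_pos hφm).1 (by positivity)⟩
  have hR1 := hR0.trans hR01
  have hex : ∃ t, 0 < t ∧ 0 < deriv h t := by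
    have hmono : ¬ AntitoneOn h (Set.Ici 0) := fun ha => by
      have := ha (Set.self_mem_Ici) (show m ∈ Set.Ici (0:ℝ) from hm.le) hm.le
      linarith
    by_contra! hcon
    apply hmono
    apply antitoneOn_of_deriv_nonpos (convex_Ici 0) hcont.continuousOn
    · intro t ht
      rw [interior_Ici] at ht
      have ht : 0 < t := ht
      refine DifferentiableAt.differentiableWithinAt ?_
      exact ((((Real.hasDerivAt_rpow_const (p := p) (Or.inl ht.ne')).div_const p).sub
        ((Real.hasDerivAt_rpow_const (p := r) (Or.inl ht.ne')).const_mul B)).sub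
        ((Real.hasDerivAt_rpow_const (p := P) (Or.inl ht.ne')).const_mul C)).differentiableAt
    · intro t ht
      rw [interior_Ici] at ht
      exact hcon t ht
  obtain ⟨q, hq, hdq⟩ := hex
  obtain ⟨a, b, ha, hab, y0, y1, D1, D2, D3⟩ := aux_ab 1 (B * r) (C * P) (p - r) (P - r)
    one_pos (by positivity) (by positivity) (by linarith) (by linarith)
    ⟨q, hq, by rw [hder q hq] at hdq; exact (pos_iff_pos_of_mul_pos hdq).1 (by positivity)⟩
  have hb := ha.trans hab
  have hneg1 : ∀ t, 0 < t → t < a → deriv h t < 0 := fun t h1 h2 => by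
    rw [hder t h1]; exact mul_neg_of_pos_of_neg (by positivity) (D1 t h1 h2)
  have hpos2 : ∀ t, a < t → t < b → 0 < deriv h t := fun t h1 h2 => by
    have := ha.trans h1
    rw [hder t this]; exact mul_pos (by positivity) (D2 t h1 h2)
  have hneg3 : ∀ t, b < t → deriv h t < 0 := fun t h1 => by
    have := hb.trans h1
    rw [hder t this]; exact mul_neg_of_pos_of_neg (by positivity) (D3 t h1)
  have M1 : StrictAntiOn h (Set.Icc 0 a) := strictAntiOn_of_deriv_neg (convex_Icc 0 a)
    hcont.continuousOn (by rw [interior_Icc]; exact fun t ht => hneg1 t ht.1 ht.2)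
  have M2 : StrictMonoOn h (Set.Icc a b) := strictMonoOn_of_deriv_pos (convex_Icc a b)
    hcont.continuousOn (by rw [interior_Icc]; exact fun t ht => hpos2 t ht.1 ht.2)
  have M3 : StrictAntiOn h (Set.Ici b) := strictAntiOn_of_deriv_neg (convex_Ici b)
    hcont.continuousOn (by rw [interior_Ici]; exact fun t ht => hneg3 t ht)
  have hzR0 : h R₀ = 0 := by rw [hfac R₀ hR0, z0, mul_zero]
  have hzR1 : h R₁ = 0 := by rw [hfac R₁ hR1, z1, mul_zero]
  have hlow : ∀ t, 0 < t → t ≤ a → h t < 0 := fun t h1 h2 => by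
    have := M1 ⟨le_rfl, ha.le⟩ ⟨h1.le, h2⟩ h1
    linarith
  have hup : ∀ t, a ≤ t → t ≠ b → h t < h b := fun t h1 h2 => by
    rcases lt_or_gt_of_ne h2 with h3 | h3
    · exact M2 ⟨h1, h3.le⟩ ⟨hab.le, le_rfl⟩ h3
    · exact M3 Set.self_mem_Ici h3.le h3
  have hma : a < m := by
    by_contra hcon
    have := hlow m hm (not_lt.1 hcon)
    linarith
  have hbpos : 0 < h b := by
    rcases eq_or_ne m b with e | e
    · rw [← e]; exact hφm
    · exact hφm.trans (hup m hma.le e)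
  have hiff : ∀ t : ℝ, 0 < t → (0 < h t ↔ R₀ < t ∧ t < R₁) := by
    intro t ht
    constructor
    · intro hh
      constructor
      · by_contra! hcon
        rcases hcon.lt_or_eq with e | e
        · have := mul_neg_of_pos_of_neg (Real.rpow_pos_of_pos ht r) (H1 t ht e)
          rw [← hfac t ht] at this; linarith
        · rw [e] at hh; linarith
      · by_contra! hcon
        rcases hcon.lt_or_eq with e | e
        · have := mul_neg_of_pos_of_neg (Real.rpow_pos_of_pos ht r) (H3 t e)
          rw [← hfac t ht] at this; linarith
        · rw [← e] at hh; linarith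
    · rintro ⟨h1, h2⟩
      rw [hfac t ht]; exact mul_pos (by positivity) (H2 t h1 h2)
  have haR : a < R₀ := by
    by_contra! hcon
    have := hlow R₀ hR0 hcon
    linarith
  refine ⟨R₀, R₁, hR0, hR01, hzR0, hzR1, hiff, a, b, ⟨ha, haR⟩, (hiff b hb).1 hbpos, ?_, ?_, ?_,
    ⟨min a (b - a), lt_min ha (by linarith), ?_⟩, hlow a ha le_rfl, ?_, hbpos⟩
  · rw [hder a ha, y0, mul_zero]
  · rw [hder b hb, y1, mul_zero]
  · intro t ht hd
    by_contra! hcon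
    rcases lt_or_gt_of_ne hcon.1 with e | e
    · have := hneg1 t ht e; linarith
    · rcases lt_or_gt_of_ne hcon.2 with e' | e'
      · have := hpos2 t e e'; linarith
      · have := hneg3 t e'; linarith
  · intro t ht hne
    rw [lt_min_iff, abs_lt, abs_lt] at ht
    rcases lt_or_gt_of_ne hne with e | e
    · exact M1 ⟨by linarith, e.le⟩ ⟨ha.le, le_rfl⟩ e
    · exact M2 ⟨le_rfl, hab.le⟩ ⟨e.le, by linarith⟩ e
  · intro t ht hne
    rcases le_total t a with e | e
    · exact (hlow t ht e).trans hbpos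
    · exact hup t e hne
end

section
/- Let A, B, C, D > 0, s ∈ (0,1), and let r, p, P be real numbers with 0 < r < sp < p < P. Define ψ : ℝ → ℝ by ψ(t) = A·e^{pt} + B·e^{spt} − C·e^{rt} − D·e^{Pt}. Assume there exists t* ∈ ℝ with ψ(t*) > 0. Then: (i) ψ(t) → 0 as t → −∞ and ψ(t) < 0 for all sufficiently negative t; (ii) ψ(t) → −∞ as t → +∞; (iii) ψ has exactly two critical points a < c; (iv) a is a strict local minimum point with ψ(a) < 0; (v) c is the strict global maximum point of ψ with ψ(c) = sup_{t∈ℝ} ψ(t) > 0, and ψ is strictly decreasing on (c, ∞); (vi) ψ has exactly two zeros b and d, and a < b < c < d. -/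
open Filter Topology

lemma four_atBot (A B C D r q p P : ℝ) (hr : 0 < r) (hrq : r < q) (hqp : q < p) (hpP : p < P) :
    Tendsto (fun t => A * Real.exp (p * t) + B * Real.exp (q * t)
      - C * Real.exp (r * t) - D * Real.exp (P * t)) atBot (𝓝 0) := by
  have key : ∀ k : ℝ, 0 < k → Tendsto (fun t => Real.exp (k * t)) atBot (𝓝 0) := fun k hk =>
    Real.tendsto_exp_atBot.comp (tendsto_id.const_mul_atBot hk)
  have := ((((key p (by linarith)).const_mul A).add ((key q (by linarith)).const_mul B)).sub
    ((key r hr).const_mul C)).sub ((key P (by linarith)).const_mul D)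
  simpa using this

lemma four_neg_atBot (A B C D r q p P : ℝ) (hC : 0 < C)
    (hrq : r < q) (hqp : q < p) (hpP : p < P) :
    ∀ᶠ t in atBot, A * Real.exp (p * t) + B * Real.exp (q * t)
      - C * Real.exp (r * t) - D * Real.exp (P * t) < 0 := by
  have key : ∀ k : ℝ, 0 < k → Tendsto (fun t => Real.exp (k * t)) atBot (𝓝 0) := fun k hk =>
    Real.tendsto_exp_atBot.comp (tendsto_id.const_mul_atBot hk)
  have h := ((((key (p - r) (by linarith)).const_mul A).add
    ((key (q - r) (by linarith)).const_mul B)).sub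
    ((key (P - r) (by linarith)).const_mul D)).sub_const C
  have h2 := h.eventually (gt_mem_nhds (show A * 0 + B * 0 - D * 0 - C < 0 by linarith))
  filter_upwards [h2] with t ht
  have e : ∀ k : ℝ, Real.exp (k * t) = Real.exp ((k - r) * t) * Real.exp (r * t) := fun k => by
    rw [← Real.exp_add]; ring_nf
  have := mul_neg_of_neg_of_pos ht (Real.exp_pos (r * t))
  rw [e p, e q, e P]
  linarith

lemma four_atTop (A B C D r q p P : ℝ) (hD : 0 < D) (hr : 0 < r)
    (hrq : r < q) (hqp : q < p) (hpP : p < P) :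
    Tendsto (fun t => A * Real.exp (p * t) + B * Real.exp (q * t)
      - C * Real.exp (r * t) - D * Real.exp (P * t)) atTop atBot := by
  have key : ∀ k : ℝ, k < 0 → Tendsto (fun t => Real.exp (k * t)) atTop (𝓝 0) := fun k hk =>
    Real.tendsto_exp_atBot.comp (tendsto_id.const_mul_atTop_of_neg hk)
  have h := ((((key (p - P) (by linarith)).const_mul A).add
    ((key (q - P) (by linarith)).const_mul B)).sub
    ((key (r - P) (by linarith)).const_mul C)).sub_const D
  have hP : Tendsto (fun t => Real.exp (P * t)) atTop atTop :=
    Real.tendsto_exp_atTop.comp (tendsto_id.const_mul_atTop (by linarith : 0 < P))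
  have h3 := hP.atTop_mul_neg (by linarith : A * 0 + B * 0 - C * 0 - D < 0) h
  refine h3.congr fun t => ?_
  have e : ∀ k : ℝ, Real.exp (k * t) = Real.exp (P * t) * Real.exp ((k - P) * t) := fun k => by
    rw [← Real.exp_add]; ring_nf
  rw [e p, e q, e r]
  ring

lemma four_between (A B C D r q p P : ℝ) (hA : 0 < A) (hB : 0 < B) (hD : 0 < D)
    (hrq : r < q) (hqp : q < p) (hpP : p < P) (x y z : ℝ) (hxy : x < y) (hyz : y < z)
    (hx : 0 ≤ A * Real.exp (p * x) + B * Real.exp (q * x)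
      - C * Real.exp (r * x) - D * Real.exp (P * x))
    (hz : 0 ≤ A * Real.exp (p * z) + B * Real.exp (q * z)
      - C * Real.exp (r * z) - D * Real.exp (P * z)) :
    0 < A * Real.exp (p * y) + B * Real.exp (q * y)
      - C * Real.exp (r * y) - D * Real.exp (P * y) := by
  have hk : 0 < p - r := by linarith
  set β := (q - r) / (p - r) with hβ
  set γ := (P - r) / (p - r) with hγ
  have hβ0 : 0 < β := div_pos (by linarith) hk
  have hβ1 : β < 1 := (div_lt_one hk).2 (by linarith)
  have hγ1 : 1 < γ := (one_lt_div hk).2 (by linarith)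
  have e : ∀ t : ℝ, A * Real.exp (p * t) + B * Real.exp (q * t)
      - C * Real.exp (r * t) - D * Real.exp (P * t) =
      (A * Real.exp ((p - r) * t) + B * Real.exp ((p - r) * t) ^ β - C
        - D * Real.exp ((p - r) * t) ^ γ) * Real.exp (r * t) := fun t => by
    rw [← Real.exp_mul, ← Real.exp_mul]
    have e1 : (p - r) * t * β = (q - r) * t := by rw [hβ]; field_simp
    have e2 : (p - r) * t * γ = (P - r) * t := by rw [hγ]; field_simp
    rw [e1, e2]
    have e : ∀ k : ℝ, Real.exp (k * t) = Real.exp ((k - r) * t) * Real.exp (r * t) := fun k => by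
      rw [← Real.exp_add]; ring_nf
    rw [e p, e q, e P]
    ring
  rw [e] at hx hz ⊢
  have hx' := nonneg_of_mul_nonneg_left hx (Real.exp_pos _)
  have hz' := nonneg_of_mul_nonneg_left hz (Real.exp_pos _)
  refine mul_pos ?_ (Real.exp_pos _)
  have huv : Real.exp ((p - r) * x) < Real.exp ((p - r) * y) :=
    Real.exp_lt_exp.2 (mul_lt_mul_of_pos_left hxy hk)
  have hvw : Real.exp ((p - r) * y) < Real.exp ((p - r) * z) :=
    Real.exp_lt_exp.2 (mul_lt_mul_of_pos_left hyz hk)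
  have hu0 := Real.exp_pos ((p - r) * x)
  generalize Real.exp ((p - r) * x) = u at *
  generalize Real.exp ((p - r) * y) = v at *
  generalize Real.exp ((p - r) * z) = w at *
  have hv : v ∈ openSegment ℝ u w := by
    rw [openSegment_eq_Ioo (huv.trans hvw)]; exact ⟨huv, hvw⟩
  obtain ⟨a, b, ha, hb, hab, rfl⟩ := hv
  have c1 := (Real.strictConcaveOn_rpow hβ0 hβ1).2 (x := u) hu0.le (y := w)
    (show (0:ℝ) ≤ w by linarith) (by linarith) ha hb hab
  have c2 := (strictConvexOn_rpow hγ1).2 (x := u) hu0.le (y := w)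
    (show (0:ℝ) ≤ w by linarith) (by linarith) ha hb hab
  simp only [smul_eq_mul] at c1 c2 ⊢
  have d1 := mul_lt_mul_of_pos_left c1 hB
  have d2 := mul_lt_mul_of_pos_left c2 hD
  have d3 := mul_nonneg ha.le hx'
  have d4 := mul_nonneg hb.le hz'
  have d5 : C = a * C + b * C := by rw [← add_mul, hab, one_mul]
  linarith

lemma four_sign (A B C D r q p P : ℝ) (hA : 0 < A) (hB : 0 < B) (hC : 0 < C) (hD : 0 < D)
    (hr : 0 < r) (hrq : r < q) (hqp : q < p) (hpP : p < P) (f : ℝ → ℝ)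
    (hf : f = fun t => A * Real.exp (p * t) + B * Real.exp (q * t)
      - C * Real.exp (r * t) - D * Real.exp (P * t)) (hpos : ∃ t, 0 < f t) :
    ∃ x y, x < y ∧ f x = 0 ∧ f y = 0 ∧ (∀ t, t < x → f t < 0) ∧
      (∀ t, x < t → t < y → 0 < f t) ∧ (∀ t, y < t → f t < 0) := by
  have hbot := four_neg_atBot A B C D r q p P hC hrq hqp hpP
  have htop := (four_atTop A B C D r q p P hD hr hrq hqp hpP).eventually (eventually_lt_atBot 0)
  have hcon : Continuous f := by rw [hf]; fun_prop
  have hbet : ∀ x y z, x < y → y < z → 0 ≤ f x → 0 ≤ f z → 0 < f y := by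
    intro x y z h1 h2 h3 h4
    rw [hf] at h3 h4 ⊢
    exact four_between A B C D r q p P hA hB hD hrq hqp hpP x y z h1 h2 h3 h4
  obtain ⟨m, hm⟩ := hpos
  obtain ⟨t0, h0, h0m⟩ := (hbot.and (eventually_lt_atBot m)).exists
  obtain ⟨t1, h1, h1m⟩ := (htop.and (eventually_gt_atTop m)).exists
  have h0 : f t0 < 0 := by rw [hf]; exact h0
  have h1 : f t1 < 0 := by rw [hf]; exact h1
  obtain ⟨x, hx, hfx⟩ := intermediate_value_Ioo h0m.le hcon.continuousOn ⟨h0, hm⟩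
  obtain ⟨y, hy, hfy⟩ := intermediate_value_Ioo' h1m.le hcon.continuousOn ⟨h1, hm⟩
  refine ⟨x, y, hx.2.trans hy.1, hfx, hfy, ?_, ?_, ?_⟩
  · intro t ht
    by_contra! h
    have := hbet t x m ht hx.2 h hm.le
    linarith
  · intro t h h'
    exact hbet x t y h h' hfx.ge hfy.ge
  · intro t ht
    by_contra! h
    have := hbet m y t hy.1 ht hm.le h
    linarith


/-- Lemma 2.3 (abstract form): the fiber map
`ψ(t) = A·e^{pt} + B·e^{spt} - C·e^{rt} - D·e^{Pt}` with `A,B,C,D > 0`, `s ∈ (0,1)`,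
`0 < r < sp < p < P`, which is positive somewhere, tends to `0⁻` at `-∞`, to `-∞` at `+∞`,
has exactly two critical points `a < c` (a strict local minimum at negative level and the
strict global maximum at positive level, with `ψ` strictly decreasing on `(c,∞)`), and
exactly two zeros `b, d` with `a < b < c < d`. -/
theorem stmt4 (A B C D s r p P : ℝ) (hA : 0 < A) (hB : 0 < B) (hC : 0 < C) (hD : 0 < D)
    (hs0 : 0 < s) (hs1 : s < 1)
    (hr : 0 < r) (hrsp : r < s * p) (hsp : s * p < p) (hpP : p < P)
    (hpos : ∃ t : ℝ, 0 < A * Real.exp (p * t) + B * Real.exp (s * p * t)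
      - C * Real.exp (r * t) - D * Real.exp (P * t)) :
    let ψ : ℝ → ℝ := fun t => A * Real.exp (p * t) + B * Real.exp (s * p * t)
      - C * Real.exp (r * t) - D * Real.exp (P * t)
    Filter.Tendsto ψ Filter.atBot (nhds 0) ∧
    (∀ᶠ t in Filter.atBot, ψ t < 0) ∧
    Filter.Tendsto ψ Filter.atTop Filter.atBot ∧
    ∃ a c : ℝ, a < c ∧ deriv ψ a = 0 ∧ deriv ψ c = 0 ∧
      (∀ t : ℝ, deriv ψ t = 0 → t = a ∨ t = c) ∧
      (∃ ε > 0, ∀ t : ℝ, |t - a| < ε → t ≠ a → ψ a < ψ t) ∧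
      ψ a < 0 ∧
      (∀ t : ℝ, t ≠ c → ψ t < ψ c) ∧
      (ψ c = ⨆ t : ℝ, ψ t) ∧
      0 < ψ c ∧
      StrictAntiOn ψ (Set.Ioi c) ∧
      ∃ b d : ℝ, ψ b = 0 ∧ ψ d = 0 ∧ (∀ t : ℝ, ψ t = 0 → t = b ∨ t = d) ∧
        a < b ∧ b < c ∧ c < d := by
  intro ψ
  have hp : 0 < p := by linarith
  have h1 := four_atBot A B C D r (s * p) p P hr hrsp hsp hpP
  have h2 := four_neg_atBot A B C D r (s * p) p P hC hrsp hsp hpP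
  have h3 := four_atTop A B C D r (s * p) p P hD hr hrsp hsp hpP
  change Tendsto ψ atBot (𝓝 0) at h1
  change ∀ᶠ t in atBot, ψ t < 0 at h2
  change ∃ t, 0 < ψ t at hpos
  refine ⟨h1, h2, h3, ?_⟩
  obtain ⟨b, d, hbd, hb, hd, hltb, hmid, hgtd⟩ :=
    four_sign A B C D r (s * p) p P hA hB hC hD hr hrsp hsp hpP ψ rfl hpos
  have hder : ∀ t, HasDerivAt ψ ((A * p) * Real.exp (p * t) + (B * (s * p)) * Real.exp (s * p * t)
      - (C * r) * Real.exp (r * t) - (D * P) * Real.exp (P * t)) t := by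
    intro t
    have key : ∀ K k : ℝ, HasDerivAt (fun t => K * Real.exp (k * t)) (K * k * Real.exp (k * t)) t := by
      intro K k
      have := (((hasDerivAt_id t).const_mul k).exp).const_mul K
      refine this.congr_deriv ?_
      simp only [id]
      ring
    exact (((key A p).add (key B (s * p))).sub (key C r)).sub (key D P)
  have hcon : Continuous ψ := continuous_iff_continuousAt.2 fun t => (hder t).continuousAt
  have hdpos : ∃ t, 0 < deriv ψ t := by
    have hlt : b - 1 < b := by linarith
    obtain ⟨t, -, ht⟩ := exists_deriv_eq_slope ψ hlt hcon.continuousOn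
      (fun t _ => (hder t).differentiableAt.differentiableWithinAt)
    refine ⟨t, ?_⟩
    rw [ht]
    have := hltb _ hlt
    exact div_pos (by linarith) (by linarith)
  obtain ⟨a, c, hac, ha, hc, hlta, hmid', hgtc⟩ :=
    four_sign (A * p) (B * (s * p)) (C * r) (D * P) r (s * p) p P (by positivity) (by positivity)
      (by positivity) (mul_pos hD (by linarith)) hr hrsp hsp hpP (deriv ψ)
      (funext fun t => (hder t).deriv) hdpos
  have anti1 : StrictAntiOn ψ (Set.Iic a) := strictAntiOn_of_deriv_neg (convex_Iic a)
    hcon.continuousOn (fun t ht => hlta t (by simpa using ht))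
  have mono : StrictMonoOn ψ (Set.Icc a c) := strictMonoOn_of_deriv_pos (convex_Icc a c)
    hcon.continuousOn (fun t ht => by rw [interior_Icc] at ht; exact hmid' t ht.1 ht.2)
  have anti2 : StrictAntiOn ψ (Set.Ici c) := strictAntiOn_of_deriv_neg (convex_Ici c)
    hcon.continuousOn (fun t ht => hgtc t (by simpa using ht))
  have hneg : ∀ t, t ≤ a → ψ t < 0 := by
    intro t ht
    have hs : ψ t < ψ (t - 1) := anti1 (show t - 1 ≤ a by linarith) ht (by linarith)
    have hle : ψ (t - 1) ≤ 0 := by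
      refine ge_of_tendsto h1 ?_
      filter_upwards [eventually_lt_atBot (t - 1)] with u hu
      exact (anti1 (show u ≤ a by linarith) (show t - 1 ≤ a by linarith) hu).le
    linarith
  have hmaxr : ∀ t, a < t → t ≠ c → ψ t < ψ c := by
    intro t hat htc
    rcases lt_or_gt_of_ne htc with h | h
    · exact mono ⟨hat.le, h.le⟩ ⟨hac.le, le_rfl⟩ h
    · exact anti2 (Set.mem_Ici.2 le_rfl) (Set.mem_Ici.2 h.le) h
  have hcpos : 0 < ψ c := by
    obtain ⟨m, hm⟩ := hpos
    have ham : a < m := by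
      by_contra! h
      have := hneg m h
      linarith
    by_cases hmc : m = c
    · rwa [← hmc]
    · exact hm.trans (hmaxr m ham hmc)
  have hmax : ∀ t, t ≠ c → ψ t < ψ c := by
    intro t htc
    rcases le_or_gt t a with h | h
    · exact (hneg t h).trans hcpos
    · exact hmaxr t h htc
  have hmaxle : ∀ t, ψ t ≤ ψ c := fun t => by
    by_cases h : t = c
    · rw [h]
    · exact (hmax t h).le
  refine ⟨a, c, hac, ha, hc, ?_, ⟨c - a, by linarith, ?_⟩, hneg a le_rfl, hmax, ?_, hcpos,
    anti2.mono Set.Ioi_subset_Ici_self, b, d, hb, hd, ?_, ?_, ?_, ?_⟩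
  · intro t ht
    by_contra! h
    rcases lt_or_gt_of_ne h.1 with h' | h'
    · have := hlta t h'
      linarith
    · rcases lt_or_gt_of_ne h.2 with h'' | h''
      · have := hmid' t h' h''
        linarith
      · have := hgtc t h''
        linarith
  · intro t ht hta
    rcases lt_or_gt_of_ne hta with h | h
    · exact anti1 h.le (Set.mem_Iic.2 le_rfl) h
    · have := (abs_lt.1 ht).2
      exact mono ⟨le_rfl, hac.le⟩ ⟨h.le, by linarith⟩ h
  · exact le_antisymm (le_ciSup (f := ψ) ⟨ψ c, by rintro _ ⟨t, rfl⟩; exact hmaxle t⟩ c)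
      (ciSup_le hmaxle)
  · intro t ht
    by_contra! h
    rcases lt_or_gt_of_ne h.1 with h' | h'
    · have := hltb t h'
      linarith
    · rcases lt_or_gt_of_ne h.2 with h'' | h''
      · have := hmid t h' h''
        linarith
      · have := hgtd t h''
        linarith
  · by_contra! h
    have := hneg b h
    linarith
  · by_contra! h
    rcases h.lt_or_eq with h | h
    · have := hltb c h
      linarith
    · rw [h] at hcpos
      linarith
  · by_contra! h
    rcases h.lt_or_eq with h | h
    · have := hgtd c h
      linarith
    · rw [← h] at hcpos
      linarith
end

section
/- Let A, B, C > 0, s ∈ (0,1), and let r, p, P be real numbers with 0 < r < sp < p < P. Define g : ℝ → ℝ by g(t) = A·e^{(p−P)t} + s·B·e^{(sp−P)t} − C·e^{(r−P)t}. Then g attains each real value at most twice: for every d ∈ ℝ, the set {t ∈ ℝ : g(t) = d} contains at most two elements. -/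
theorem stmt5_aux (a b c α β γ d : ℝ) (ha : 0 < a) (hb : 0 < b) (hγβ : γ < β) (hβα : β < α)
    (hα : α < 0) (x y z : ℝ) (hxy : x < y) (hyz : y < z)
    (hx : a * Real.exp (α * x) + b * Real.exp (β * x) - c * Real.exp (γ * x) = d)
    (hy : a * Real.exp (α * y) + b * Real.exp (β * y) - c * Real.exp (γ * y) = d)
    (hz : a * Real.exp (α * z) + b * Real.exp (β * z) - c * Real.exp (γ * z) = d) : False := by
  have e : ∀ k t : ℝ, HasDerivAt (fun t => Real.exp (k * t)) (Real.exp (k * t) * k) t := by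
    intro k t
    simpa using ((hasDerivAt_id t).const_mul k).exp
  have hd : ∀ t, HasDerivAt
      (fun t => a * Real.exp (α * t) + b * Real.exp (β * t) - c * Real.exp (γ * t))
      (a * (Real.exp (α * t) * α) + b * (Real.exp (β * t) * β) - c * (Real.exp (γ * t) * γ)) t :=
    fun t => (((e α t).const_mul a).add ((e β t).const_mul b)).sub ((e γ t).const_mul c)
  obtain ⟨u, hu, hu0⟩ := exists_hasDerivAt_eq_zero hxy
    (fun t _ => (hd t).continuousAt.continuousWithinAt) (hx.trans hy.symm) (fun t _ => hd t)
  obtain ⟨v, hv, hv0⟩ := exists_hasDerivAt_eq_zero hyz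
    (fun t _ => (hd t).continuousAt.continuousWithinAt) (hy.trans hz.symm) (fun t _ => hd t)
  have huv : u < v := hu.2.trans hv.1
  have key : ∀ t, a * (Real.exp (α * t) * α) + b * (Real.exp (β * t) * β)
      - c * (Real.exp (γ * t) * γ) = 0 →
      a * α * Real.exp ((α - γ) * t) + b * β * Real.exp ((β - γ) * t) = c * γ := by
    intro t ht
    have h1 : Real.exp (α * t) = Real.exp ((α - γ) * t) * Real.exp (γ * t) := by
      rw [← Real.exp_add]; ring_nf
    have h2 : Real.exp (β * t) = Real.exp ((β - γ) * t) * Real.exp (γ * t) := by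
      rw [← Real.exp_add]; ring_nf
    rw [h1, h2] at ht
    apply mul_right_cancel₀ (Real.exp_pos (γ * t)).ne'
    linarith
  have ku := key u hu0
  have kv := key v hv0
  have m1 : Real.exp ((α - γ) * u) < Real.exp ((α - γ) * v) :=
    Real.exp_lt_exp.2 (mul_lt_mul_of_pos_left huv (by linarith))
  have m2 : Real.exp ((β - γ) * u) < Real.exp ((β - γ) * v) :=
    Real.exp_lt_exp.2 (mul_lt_mul_of_pos_left huv (by linarith))
  have n1 := mul_lt_mul_of_neg_left m1 (mul_neg_of_pos_of_neg ha hα)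
  have n2 := mul_lt_mul_of_neg_left m2 (mul_neg_of_pos_of_neg hb (hβα.trans hα))
  linarith

/-- The function `g(t) = A·e^{(p-P)t} + s·B·e^{(sp-P)t} - C·e^{(r-P)t}` (with `A,B,C > 0`,
`s ∈ (0,1)`, `0 < r < sp < p < P`) attains each real value at most twice. -/
theorem stmt5 (A B C s r p P : ℝ) (hA : 0 < A) (hB : 0 < B) (hC : 0 < C)
    (hs0 : 0 < s) (hs1 : s < 1)
    (hr : 0 < r) (hrsp : r < s * p) (hsp : s * p < p) (hpP : p < P) (d : ℝ) :
    Set.encard {t : ℝ | A * Real.exp ((p - P) * t) + s * B * Real.exp ((s * p - P) * t)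
      - C * Real.exp ((r - P) * t) = d} ≤ 2 := by
  have aux := stmt5_aux A (s * B) C (p - P) (s * p - P) (r - P) d hA (mul_pos hs0 hB)
    (by linarith) (by linarith) (by linarith)
  by_contra h
  have h3 : (3 : ℕ∞) ≤ Set.encard {t : ℝ | A * Real.exp ((p - P) * t)
      + s * B * Real.exp ((s * p - P) * t) - C * Real.exp ((r - P) * t) = d} := by
    have := Order.add_one_le_of_lt (not_le.1 h)
    norm_num at this
    exact this
  obtain ⟨T, hT, hT3⟩ := Set.exists_subset_encard_eq h3
  obtain ⟨x, y, z, hxy, hxz, hyz, rfl⟩ := Set.encard_eq_three.1 hT3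
  have hx := hT (show x ∈ ({x, y, z} : Set ℝ) by simp)
  have hy := hT (show y ∈ ({x, y, z} : Set ℝ) by simp)
  have hz := hT (show z ∈ ({x, y, z} : Set ℝ) by simp)
  rcases lt_or_gt_of_ne hxy with h1 | h1 <;> rcases lt_or_gt_of_ne hxz with h2 | h2 <;>
    rcases lt_or_gt_of_ne hyz with h3 | h3
  · exact aux x y z h1 h3 hx hy hz
  · exact aux x z y h2 h3 hx hz hy
  · linarith
  · exact aux z x y h2 h1 hz hx hy
  · exact aux y x z h1 h2 hy hx hz
  · linarith
  · exact aux y z x h3 h2 hy hz hx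
  · exact aux z y x h3 h1 hz hy hx
end

section
/- Let p ≥ 2 be a real number, x ≥ 0, and t₀ > 0. Then for all t ∈ [0, t₀], one has (1 + t·x)^p ≤ 1 + (t·x)^p + p·t·x·((1 + t₀·x)^{p−1} − (t₀·x)^{p−1}). -/
theorem stmt6_hasDeriv (q : ℝ) (hq : 1 ≤ q) (y : ℝ) :
    HasDerivAt (fun y : ℝ => (1 + y) ^ q - y ^ q) (q * ((1 + y) ^ (q - 1) - y ^ (q - 1))) y := by
  have h1 : HasDerivAt (fun y : ℝ => 1 + y) 1 y := (hasDerivAt_id y).const_add 1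
  have h2 := (h1.rpow_const (p := q) (Or.inr hq)).sub
    (Real.hasDerivAt_rpow_const (x := y) (p := q) (Or.inr hq))
  exact h2.congr_deriv (by ring)

theorem stmt6_mono (q : ℝ) (hq : 1 ≤ q) :
    MonotoneOn (fun y : ℝ => (1 + y) ^ q - y ^ q) (Set.Ici 0) := by
  apply monotoneOn_of_deriv_nonneg (convex_Ici 0)
  · exact fun y _ => (stmt6_hasDeriv q hq y).continuousAt.continuousWithinAt
  · exact fun y _ => (stmt6_hasDeriv q hq y).differentiableAt.differentiableWithinAt
  · intro y hy
    rw [interior_Ici] at hy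
    have hy0 : 0 ≤ y := le_of_lt hy
    rw [(stmt6_hasDeriv q hq y).deriv]
    have := Real.rpow_le_rpow hy0 (by linarith : y ≤ 1 + y) (by linarith : 0 ≤ q - 1)
    exact mul_nonneg (by linarith) (by linarith)

theorem stmt6_anti (p z : ℝ) (hp : 2 ≤ p) (hz : 0 ≤ z) :
    AntitoneOn (fun y : ℝ => ((1 + y) ^ p - y ^ p)
      - (p * ((1 + z) ^ (p - 1) - z ^ (p - 1))) * y) (Set.Icc 0 z) := by
  have hd := fun y : ℝ => (stmt6_hasDeriv p (by linarith) y).sub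
    ((hasDerivAt_id y).const_mul (p * ((1 + z) ^ (p - 1) - z ^ (p - 1))))
  apply antitoneOn_of_deriv_nonpos (convex_Icc 0 z)
  · exact fun y _ => (hd y).continuousAt.continuousWithinAt
  · exact fun y _ => (hd y).differentiableAt.differentiableWithinAt
  · intro y hy
    have hy' := interior_subset hy
    refine (hd y).deriv.trans_le ?_
    have h : (1 + y) ^ (p - 1) - y ^ (p - 1) ≤ (1 + z) ^ (p - 1) - z ^ (p - 1) :=
      stmt6_mono (p - 1) (by linarith) hy'.1 hz hy'.2
    have := mul_le_mul_of_nonneg_left h (by linarith : 0 ≤ p)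
    linarith

/-- Scalar inequality behind Lemma 5.1: for `p ≥ 2`, `x ≥ 0`, `t₀ > 0` and `t ∈ [0, t₀]`,
`(1 + tx)^p ≤ 1 + (tx)^p + p·t·x·((1 + t₀x)^{p-1} - (t₀x)^{p-1})` (real powers). -/
theorem stmt6 (p x t₀ : ℝ) (hp : 2 ≤ p) (hx : 0 ≤ x) (ht₀ : 0 < t₀)
    (t : ℝ) (ht : t ∈ Set.Icc 0 t₀) :
    (1 + t * x) ^ p ≤
      1 + (t * x) ^ p + p * t * x * ((1 + t₀ * x) ^ (p - 1) - (t₀ * x) ^ (p - 1)) := by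
  have hz : 0 ≤ t₀ * x := mul_nonneg ht₀.le hx
  have hy : 0 ≤ t * x := mul_nonneg ht.1 hx
  have hyz : t * x ≤ t₀ * x := mul_le_mul_of_nonneg_right ht.2 hx
  have h := stmt6_anti p (t₀ * x) hp hz ⟨le_refl 0, hz⟩ ⟨hy, hyz⟩ hy
  have h0 : (0 : ℝ) ^ p = 0 := Real.zero_rpow (by linarith)
  simp only [add_zero, Real.one_rpow, h0, mul_zero, sub_zero] at h
  linarith
end

section
/- Let N ≥ 1, s ∈ (0,1), let p ≥ 2 be a real number, and for measurable f : ℝ^N → ℝ let the Gagliardo seminorm be defined by [f]_{s,p}^p = ∫_{ℝ^N}∫_{ℝ^N} |f(x)−f(y)|^p / |x−y|^{N+sp} dx dy. Let u, w : ℝ^N → ℝ be measurable with 0 < [u]_{s,p} < ∞ and [w]_{s,p} < ∞, and let t₀ ≥ 1. Set K₃ = (1 + t₀·[w]_{s,p}/[u]_{s,p})^{p−1} − (t₀·[w]_{s,p}/[u]_{s,p})^{p−1}. Then for every t ∈ [1/t₀, t₀], one has [u + t·w]_{s,p}^p ≤ [u]_{s,p}^p + t^p·[w]_{s,p}^p +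 p·t·K₃·[w]_{s,p}·[u]_{s,p}^{p−1}. -/
open MeasureTheory ENNReal

/-- The `p`-th power of the Gagliardo `(s,p)`-seminorm of `f : ℝ^N → ℝ`, i.e.
`[f]_{s,p}^p = ∫∫ |f(x)-f(y)|^p / |x-y|^{N+sp} dx dy`, as a value in `[0,∞]`. -/
noncomputable def gagliardoP (N : ℕ) (s p : ℝ) (f : EuclideanSpace ℝ (Fin N) → ℝ) : ℝ≥0∞ :=
  ∫⁻ x, ∫⁻ y, ENNReal.ofReal (|f x - f y| ^ p / dist x y ^ ((N : ℝ) + s * p))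

/-- `(1+y)^q - y^q` is monotone for `q ≥ 1`. -/
lemma g_mono (q : ℝ) (hq : 1 ≤ q) {y b : ℝ} (hy : 0 ≤ y) (hyb : y ≤ b) :
    (1 + y) ^ q - y ^ q ≤ (1 + b) ^ q - b ^ q := by
  have hd : ∀ x : ℝ, HasDerivAt (fun y : ℝ => (1 + y) ^ q - y ^ q)
      (1 * q * (1 + x) ^ (q - 1) - 1 * q * x ^ (q - 1)) x := fun x =>
    (((hasDerivAt_id x).const_add 1).rpow_const (Or.inr hq)).sub
      ((hasDerivAt_id x).rpow_const (Or.inr hq))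
  have hm : MonotoneOn (fun y : ℝ => (1 + y) ^ q - y ^ q) (Set.Ici 0) := by
    refine monotoneOn_of_deriv_nonneg (convex_Ici 0)
      (fun x _ => (hd x).continuousAt.continuousWithinAt)
      (fun x _ => (hd x).differentiableAt.differentiableWithinAt) ?_
    intro x hx
    rw [interior_Ici] at hx
    have hx' : (0 : ℝ) < x := hx
    rw [(hd x).deriv]
    have : x ^ (q - 1) ≤ (1 + x) ^ (q - 1) :=
      Real.rpow_le_rpow hx'.le (by linarith) (by linarith)
    nlinarith
  exact hm hy (hy.trans hyb) hyb

lemma scalar_est (p : ℝ) (hp : 2 ≤ p) {b b₀ : ℝ} (hb : 0 ≤ b) (hbb : b ≤ b₀) :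
    (1 + b) ^ p ≤ 1 + b ^ p + p * b * ((1 + b₀) ^ (p - 1) - b₀ ^ (p - 1)) := by
  set C := (1 + b₀) ^ (p - 1) - b₀ ^ (p - 1) with hC
  have hp1 : 1 ≤ p := by linarith
  have hd : ∀ x : ℝ, HasDerivAt (fun y : ℝ => y ^ p + (p * C) * y - (1 + y) ^ p)
      (1 * p * x ^ (p - 1) + (p * C) * 1 - 1 * p * (1 + x) ^ (p - 1)) x := fun x =>
    (((hasDerivAt_id x).rpow_const (Or.inr hp1)).add ((hasDerivAt_id x).const_mul (p * C))).sub
      (((hasDerivAt_id x).const_add 1).rpow_const (Or.inr hp1))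
  have hm : MonotoneOn (fun y : ℝ => y ^ p + (p * C) * y - (1 + y) ^ p) (Set.Icc 0 b₀) := by
    refine monotoneOn_of_deriv_nonneg (convex_Icc 0 b₀)
      (fun x _ => (hd x).continuousAt.continuousWithinAt)
      (fun x _ => (hd x).differentiableAt.differentiableWithinAt) ?_
    intro x hx
    rw [interior_Icc] at hx
    rw [(hd x).deriv]
    have := g_mono (p - 1) (by linarith) hx.1.le hx.2.le
    rw [← hC] at this
    nlinarith
  have h := hm (Set.left_mem_Icc.2 (hb.trans hbb)) ⟨hb, hbb⟩ hb
  have h0 : (0 : ℝ) ^ p = 0 := Real.zero_rpow (by linarith)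
  simp only [h0, add_zero, mul_zero, Real.one_rpow] at h
  linarith

/-- Density whose `p`-th power is the Gagliardo integrand. -/
noncomputable def gDens (N : ℕ) (s p : ℝ) (f : EuclideanSpace ℝ (Fin N) → ℝ)
    (z : EuclideanSpace ℝ (Fin N) × EuclideanSpace ℝ (Fin N)) : ℝ≥0∞ :=
  ENNReal.ofReal (|f z.1 - f z.2| / dist z.1 z.2 ^ (((N : ℝ) + s * p) / p))

lemma gDens_meas (N : ℕ) (s p : ℝ) (f : EuclideanSpace ℝ (Fin N) → ℝ) (hf : Measurable f) :
    Measurable (gDens N s p f) := by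
  unfold gDens
  have h1 : Measurable fun z : EuclideanSpace ℝ (Fin N) × EuclideanSpace ℝ (Fin N) =>
      dist z.1 z.2 := measurable_dist
  have h2 : Measurable fun z : EuclideanSpace ℝ (Fin N) × EuclideanSpace ℝ (Fin N) =>
      |f z.1 - f z.2| := by
    have := (hf.comp measurable_fst).sub (hf.comp measurable_snd)
      (f := fun z : EuclideanSpace ℝ (Fin N) × EuclideanSpace ℝ (Fin N) => f z.1)
    simpa [Real.norm_eq_abs] using this.norm
  exact (h2.div (h1.pow_const _)).ennreal_ofReal

lemma gagliardoP_eq (N : ℕ) (s p : ℝ) (hp : 0 < p)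
    (f : EuclideanSpace ℝ (Fin N) → ℝ) (hf : Measurable f) :
    gagliardoP N s p f = ∫⁻ z, gDens N s p f z ^ p ∂(volume.prod volume) := by
  rw [lintegral_prod _ ((gDens_meas N s p f hf).pow_const p).aemeasurable]
  unfold gagliardoP gDens
  refine lintegral_congr fun x => lintegral_congr fun y => ?_
  rw [ENNReal.ofReal_rpow_of_nonneg (by positivity) hp.le,
    Real.div_rpow (abs_nonneg _) (by positivity), ← Real.rpow_mul dist_nonneg,
    div_mul_cancel₀ _ hp.ne']

lemma gDens_add_le (N : ℕ) (s p : ℝ) (u w : EuclideanSpace ℝ (Fin N) → ℝ) (t : ℝ) (ht : 0 ≤ t) (z) :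
    gDens N s p (fun x => u x + t * w x) z ≤
      gDens N s p u z + ENNReal.ofReal t * gDens N s p w z := by
  unfold gDens
  rw [← ENNReal.ofReal_mul ht, ← ENNReal.ofReal_add (by positivity) (by positivity)]
  apply ENNReal.ofReal_le_ofReal
  rw [← mul_div_assoc, ← add_div]
  gcongr
  calc |u z.1 + t * w z.1 - (u z.2 + t * w z.2)|
      = |(u z.1 - u z.2) + t * (w z.1 - w z.2)| := by congr 1; ring
    _ ≤ |u z.1 - u z.2| + |t * (w z.1 - w z.2)| := abs_add_le _ _
    _ = _ := by rw [abs_mul, abs_of_nonneg ht]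

lemma gag_minkowski (N : ℕ) (s p : ℝ) (hp : 1 ≤ p)
    (u w : EuclideanSpace ℝ (Fin N) → ℝ) (hum : Measurable u) (hwm : Measurable w)
    (t : ℝ) (ht : 0 ≤ t) :
    gagliardoP N s p (fun x => u x + t * w x) ≤
      (gagliardoP N s p u ^ (1 / p) + ENNReal.ofReal t * gagliardoP N s p w ^ (1 / p)) ^ p := by
  have hp0 : 0 < p := by linarith
  have hu := gDens_meas N s p u hum
  have hw := gDens_meas N s p w hwm
  have key := ENNReal.lintegral_Lp_add_le (μ := volume.prod volume) hu.aemeasurable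
    (hw.const_mul (ENNReal.ofReal t)).aemeasurable hp
  have e2 : (∫⁻ z, (ENNReal.ofReal t * gDens N s p w z) ^ p ∂(volume.prod volume)) ^ (1 / p)
      = ENNReal.ofReal t * gagliardoP N s p w ^ (1 / p) := by
    simp_rw [ENNReal.mul_rpow_of_nonneg _ _ hp0.le]
    rw [lintegral_const_mul _ (hw.pow_const p), ← gagliardoP_eq N s p hp0 w hwm,
      ENNReal.mul_rpow_of_nonneg _ _ (by positivity), ← ENNReal.rpow_mul,
      mul_one_div_cancel hp0.ne', ENNReal.rpow_one]
  rw [e2, ← gagliardoP_eq N s p hp0 u hum] at key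
  rw [gagliardoP_eq N s p hp0 (fun x => u x + t * w x) (hum.add (hwm.const_mul t))]
  calc _ ≤ ∫⁻ z, (gDens N s p u z + ENNReal.ofReal t * gDens N s p w z) ^ p
        ∂(volume.prod volume) :=
        lintegral_mono fun z => ENNReal.rpow_le_rpow (gDens_add_le N s p u w t ht z) hp0.le
    _ ≤ _ := by
        have := ENNReal.rpow_le_rpow key hp0.le
        rw [← ENNReal.rpow_mul, one_div_mul_cancel hp0.ne', ENNReal.rpow_one] at this
        exact this

/-- Part (3) of Lemma 5.1: for `p ≥ 2`, `s ∈ (0,1)`, measurable `u, w` with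
`0 < [u]_{s,p} < ∞`, `[w]_{s,p} < ∞`, `t₀ ≥ 1`,
`K₃ = (1 + t₀[w]/[u])^{p-1} - (t₀[w]/[u])^{p-1}`, and `t ∈ [1/t₀, t₀]`, one has
`[u + tw]_{s,p}^p ≤ [u]_{s,p}^p + t^p [w]_{s,p}^p + p t K₃ [w]_{s,p} [u]_{s,p}^{p-1}`. -/
theorem stmt9 (N : ℕ) (hN : 1 ≤ N) (s p : ℝ) (hs0 : 0 < s) (hs1 : s < 1) (hp : 2 ≤ p)
    (u w : EuclideanSpace ℝ (Fin N) → ℝ) (hum : Measurable u) (hwm : Measurable w)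
    (hu0 : 0 < gagliardoP N s p u) (hufin : gagliardoP N s p u < ⊤)
    (hwfin : gagliardoP N s p w < ⊤)
    (t₀ : ℝ) (ht₀ : 1 ≤ t₀) (t : ℝ) (ht : t ∈ Set.Icc (1 / t₀) t₀) :
    let Ju : ℝ := (gagliardoP N s p u).toReal ^ (1 / p)
    let Jw : ℝ := (gagliardoP N s p w).toReal ^ (1 / p)
    let K₃ : ℝ := (1 + t₀ * Jw / Ju) ^ (p - 1) - (t₀ * Jw / Ju) ^ (p - 1)
    gagliardoP N s p (fun x => u x + t * w x) ≤
      ENNReal.ofReal ((gagliardoP N s p u).toReal + t ^ p * (gagliardoP N s p w).toReal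
        + p * t * K₃ * Jw * Ju ^ (p - 1)) := by
  intro Ju Jw K₃
  have hp0 : 0 < p := by linarith
  have ht0 : 0 ≤ t := le_trans (by positivity) ht.1
  have hU : 0 < (gagliardoP N s p u).toReal := ENNReal.toReal_pos hu0.ne' hufin.ne
  have hJu : 0 < Ju := Real.rpow_pos_of_pos hU _
  have hJw : 0 ≤ Jw := Real.rpow_nonneg ENNReal.toReal_nonneg _
  have eu : gagliardoP N s p u ^ (1 / p) = ENNReal.ofReal Ju := by
    rw [← ENNReal.ofReal_rpow_of_nonneg ENNReal.toReal_nonneg (by positivity),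
      ENNReal.ofReal_toReal hufin.ne]
  have ew : gagliardoP N s p w ^ (1 / p) = ENNReal.ofReal Jw := by
    rw [← ENNReal.ofReal_rpow_of_nonneg ENNReal.toReal_nonneg (by positivity),
      ENNReal.ofReal_toReal hwfin.ne]
  have pu : (gagliardoP N s p u).toReal = Ju ^ p := by
    rw [← Real.rpow_mul ENNReal.toReal_nonneg, one_div_mul_cancel hp0.ne', Real.rpow_one]
  have pw : (gagliardoP N s p w).toReal = Jw ^ p := by
    rw [← Real.rpow_mul ENNReal.toReal_nonneg, one_div_mul_cancel hp0.ne', Real.rpow_one]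
  have key := gag_minkowski N s p (by linarith) u w hum hwm t ht0
  rw [eu, ew, ← ENNReal.ofReal_mul ht0, ← ENNReal.ofReal_add hJu.le (by positivity),
    ENNReal.ofReal_rpow_of_nonneg (by positivity) hp0.le] at key
  refine key.trans (ENNReal.ofReal_le_ofReal ?_)
  rw [pu, pw]
  have hb : t * Jw / Ju ≤ t₀ * Jw / Ju := by
    have := ht.2
    gcongr
  have hsc : (1 + t * Jw / Ju) ^ p ≤ 1 + (t * Jw / Ju) ^ p + p * (t * Jw / Ju) * K₃ :=
    scalar_est p hp (by positivity) hb
  have h1 : Ju + t * Jw = Ju * (1 + t * Jw / Ju) := by field_simp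
  have h2 : Ju ^ p * (t * Jw / Ju) ^ p = t ^ p * Jw ^ p := by
    rw [← Real.mul_rpow hJu.le (by positivity), mul_div_cancel₀ _ hJu.ne',
      Real.mul_rpow ht0 hJw]
  have h3 : Ju ^ p = Ju ^ (p - 1) * Ju := by
    rw [← Real.rpow_add_one hJu.ne']; congr 1; ring
  have h4 : Ju ^ p * (p * (t * Jw / Ju) * K₃) = p * t * K₃ * Jw * Ju ^ (p - 1) := by
    rw [h3]; field_simp
  rw [h1, Real.mul_rpow hJu.le (by positivity)]
  calc _ ≤ Ju ^ p * (1 + (t * Jw / Ju) ^ p + p * (t * Jw / Ju) * K₃) := by gcongr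
    _ = _ := by rw [mul_add, mul_add, h2, h4, mul_one]
end

section
/- Let a, b, c, d > 0 be real numbers and let z > 1 be a real number. Then (a+b)^z · (c+d)^z ≥ a^z·c^z + b^z·d^z + z·a^{z−1}·c^z·b + z·a^z·c^{z−1}·d. -/
/-- Elementary inequality from the proof of Lemma 4.1: for `a,b,c,d > 0` and `z > 1`,
`(a+b)^z (c+d)^z ≥ a^z c^z + b^z d^z + z a^{z-1} c^z b + z a^z c^{z-1} d` (real powers). -/
theorem stmt10 (a b c d z : ℝ) (ha : 0 < a) (hb : 0 < b) (hc : 0 < c) (hd : 0 < d)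
    (hz : 1 < z) :
    a ^ z * c ^ z + b ^ z * d ^ z + z * a ^ (z - 1) * c ^ z * b + z * a ^ z * c ^ (z - 1) * d ≤
      (a + b) ^ z * (c + d) ^ z := by
  have hz1 : (1:ℝ) ≤ z := hz.le
  have key : (a * c + b * c + a * d) ^ z + (b * d) ^ z ≤ (a * c + b * c + a * d + b * d) ^ z := by
    have h := NNReal.add_rpow_le_rpow_add (p := z)
      ⟨a * c + b * c + a * d, by positivity⟩ ⟨b * d, by positivity⟩ hz1
    exact_mod_cast h
  have hu : 0 < b / a + d / c := by positivity
  have bern := one_add_mul_self_le_rpow_one_add (s := b / a + d / c) (by linarith) hz1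
  have e1 : a * c + b * c + a * d = a * c * (1 + (b / a + d / c)) := by
    field_simp
    try ring
  have e2 : (a * c + b * c + a * d) ^ z = a ^ z * c ^ z * (1 + (b / a + d / c)) ^ z := by
    rw [e1, Real.mul_rpow (by positivity) (by positivity), Real.mul_rpow ha.le hc.le]
  have e3 : (a + b) ^ z * (c + d) ^ z = (a * c + b * c + a * d + b * d) ^ z := by
    rw [← Real.mul_rpow (by positivity) (by positivity)]
    congr 1
    ring
  have hm := mul_le_mul_of_nonneg_left bern (show 0 ≤ a ^ z * c ^ z by positivity)
  rw [e3]
  rw [e2, Real.mul_rpow hb.le hd.le] at key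
  refine le_trans ?_ key
  rw [Real.rpow_sub_one ha.ne', Real.rpow_sub_one hc.ne']
  have e4 : a ^ z * c ^ z * (1 + z * (b / a + d / c)) = a ^ z * c ^ z
      + z * (a ^ z / a) * c ^ z * b + z * a ^ z * (c ^ z / c) * d := by
    ring
  linarith
end

section
/- Let N ≥ 3, let α ∈ (0, N), let P > 1 be a real number, and let u, v : ℝ^N → [0,∞) be measurable. Define, for measurable f : ℝ^N → [0,∞), the Choquard energy A(f) = ∫_{ℝ^N}∫_{ℝ^N} f(x)^P f(y)^P |x−y|^{α−N} dx dy, with values in [0,∞]. Then A(u+v) ≥ A(u) + A(v) + 2P·∫_{ℝ^N}∫_{ℝ^N} u(x)^{P−1} v(x) u(y)^P |x−y|^{α−N} dx dy. -/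
open MeasureTheory ENNReal

/-- The critical Choquard energy `A(f) = ∫∫ f(x)^P f(y)^P |x-y|^{α-N} dx dy` of a
nonnegative function `f : ℝ^N → [0,∞)`, with values in `[0,∞]`. -/
noncomputable def choqA (N : ℕ) (α P : ℝ) (f : EuclideanSpace ℝ (Fin N) → ℝ) : ℝ≥0∞ :=
  ∫⁻ x, ∫⁻ y, ENNReal.ofReal (f x ^ P) * ENNReal.ofReal (f y ^ P) *
    ENNReal.ofReal (dist x y) ^ (α - (N : ℝ))

theorem choq_bern {s t z : ℝ} (hs : 0 ≤ s) (ht : 0 ≤ t) (hz : 1 < z) :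
    s ^ z + z * s ^ (z - 1) * t ≤ (s + t) ^ z := by
  rcases hs.eq_or_lt with rfl | hs
  · rw [Real.zero_rpow (by linarith), Real.zero_rpow (by linarith)]
    simpa using Real.rpow_nonneg ht z
  · have h := one_add_mul_self_le_rpow_one_add (s := t / s) (p := z)
      (by have : 0 ≤ t / s := by positivity
          linarith) hz.le
    have e : s + t = s * (1 + t / s) := by field_simp
    rw [e, Real.mul_rpow hs.le (by positivity)]
    have h2 := mul_le_mul_of_nonneg_left h (Real.rpow_nonneg hs.le z)
    refine le_trans (le_of_eq ?_) h2
    rw [Real.rpow_sub_one hs.ne']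
    field_simp

theorem choq_ptwise {a b c d z : ℝ} (ha : 0 ≤ a) (hb : 0 ≤ b) (hc : 0 ≤ c) (hd : 0 ≤ d)
    (hz : 1 < z) :
    a ^ z * c ^ z + b ^ z * d ^ z + z * (a ^ (z - 1) * b * c ^ z)
      + z * (c ^ (z - 1) * d * a ^ z) ≤ (a + b) ^ z * (c + d) ^ z := by
  have key : ∀ {r : ℝ}, 0 ≤ r → r ^ z = r ^ (z - 1) * r := by
    intro r hr
    rcases hr.eq_or_lt with rfl | hr
    · rw [Real.zero_rpow (by linarith)]; simp
    · rw [Real.rpow_sub_one hr.ne']; field_simp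
  rw [← Real.mul_rpow (x := a + b) (by positivity) (by positivity)]
  have e : (a + b) * (c + d) = (a * c + (a * d + b * c)) + b * d := by ring
  rw [e]
  have h1 := Real.add_rpow_le_rpow_add (a := a * c + (a * d + b * c)) (b := b * d)
    (by positivity) (by positivity) hz.le
  have h2 := choq_bern (s := a * c) (t := a * d + b * c) (z := z)
    (by positivity) (by positivity) hz
  rw [Real.mul_rpow ha hc, Real.mul_rpow ha hc] at h2
  rw [Real.mul_rpow hb hd] at h1
  have e2 : z * (a ^ (z - 1) * b * c ^ z) + z * (c ^ (z - 1) * d * a ^ z)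
      = z * (a ^ (z - 1) * c ^ (z - 1)) * (a * d + b * c) := by
    rw [key ha, key hc]; ring
  linarith

set_option maxHeartbeats 2000000 in
/-- Superadditivity of the Choquard energy (inequality (4.22) of the paper): for `N ≥ 3`,
`α ∈ (0,N)`, `P > 1`, and nonnegative measurable `u, v : ℝ^N → [0,∞)`,
`A(u+v) ≥ A(u) + A(v) + 2P ∫∫ u(x)^{P-1} v(x) u(y)^P |x-y|^{α-N} dx dy`. -/
theorem stmt11 (N : ℕ) (hN : 3 ≤ N) (α P : ℝ) (hα0 : 0 < α) (hαN : α < N) (hP : 1 < P)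
    (u v : EuclideanSpace ℝ (Fin N) → ℝ) (hum : Measurable u) (hvm : Measurable v)
    (hu0 : ∀ x, 0 ≤ u x) (hv0 : ∀ x, 0 ≤ v x) :
    choqA N α P u + choqA N α P v +
      ENNReal.ofReal (2 * P) *
        (∫⁻ x, ∫⁻ y, ENNReal.ofReal (u x ^ (P - 1) * v x) * ENNReal.ofReal (u y ^ P) *
          ENNReal.ofReal (dist x y) ^ (α - (N : ℝ))) ≤
      choqA N α P (u + v) := by
  set K : EuclideanSpace ℝ (Fin N) → EuclideanSpace ℝ (Fin N) → ℝ≥0∞ :=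
    fun x y => ENNReal.ofReal (dist x y) ^ (α - (N : ℝ)) with hK
  have hKm : Measurable (fun p : EuclideanSpace ℝ (Fin N) × EuclideanSpace ℝ (Fin N) =>
      K p.1 p.2) := by
    simp only [hK]
    fun_prop
  have hKs : ∀ x y, K x y = K y x := fun x y => by simp only [hK, dist_comm]
  set F1 : EuclideanSpace ℝ (Fin N) → EuclideanSpace ℝ (Fin N) → ℝ≥0∞ :=
    fun x y => ENNReal.ofReal (u x ^ P) * ENNReal.ofReal (u y ^ P) * K x y with hF1
  set F2 : EuclideanSpace ℝ (Fin N) → EuclideanSpace ℝ (Fin N) → ℝ≥0∞ :=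
    fun x y => ENNReal.ofReal (v x ^ P) * ENNReal.ofReal (v y ^ P) * K x y with hF2
  set G : EuclideanSpace ℝ (Fin N) → EuclideanSpace ℝ (Fin N) → ℝ≥0∞ :=
    fun x y => ENNReal.ofReal (u x ^ (P - 1) * v x) * ENNReal.ofReal (u y ^ P) * K x y with hG
  have m1 : Measurable (Function.uncurry F1) := by
    simp only [hF1, Function.uncurry_def]
    fun_prop
  have m2 : Measurable (Function.uncurry F2) := by
    simp only [hF2, Function.uncurry_def]
    fun_prop
  have mG : Measurable (Function.uncurry G) := by
    simp only [hG, Function.uncurry_def]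
    fun_prop
  have mG' : Measurable (Function.uncurry fun x y => G y x) := mG.comp measurable_swap
  have hswap : ∫⁻ x, ∫⁻ y, G y x = ∫⁻ x, ∫⁻ y, G x y :=
    lintegral_lintegral_swap mG'.aemeasurable
  have hadd : ∀ A B : EuclideanSpace ℝ (Fin N) → EuclideanSpace ℝ (Fin N) → ℝ≥0∞,
      Measurable (Function.uncurry A) →
      (∫⁻ x, ∫⁻ y, A x y) + (∫⁻ x, ∫⁻ y, B x y) = ∫⁻ x, ∫⁻ y, (A x y + B x y) := by
    intro A B hA
    have hA' : Measurable fun x => ∫⁻ y, A x y := hA.lintegral_prod_right'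
    rw [← lintegral_add_left hA']
    refine lintegral_congr fun x => ?_
    rw [← lintegral_add_left]
    exact hA.of_uncurry_left
  have hcm : ∀ A : EuclideanSpace ℝ (Fin N) → EuclideanSpace ℝ (Fin N) → ℝ≥0∞,
      ENNReal.ofReal P * (∫⁻ x, ∫⁻ y, A x y) = ∫⁻ x, ∫⁻ y, ENNReal.ofReal P * A x y := by
    intro A
    rw [← lintegral_const_mul' _ _ ENNReal.ofReal_ne_top]
    refine lintegral_congr fun x => ?_
    rw [← lintegral_const_mul' _ _ ENNReal.ofReal_ne_top]
  have h2P : ENNReal.ofReal (2 * P) * (∫⁻ x, ∫⁻ y, G x y)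
      = (∫⁻ x, ∫⁻ y, ENNReal.ofReal P * G x y) + ∫⁻ x, ∫⁻ y, ENNReal.ofReal P * G y x := by
    rw [← hcm, ← hcm (fun x y => G y x), hswap, two_mul,
      ENNReal.ofReal_add (by linarith) (by linarith), add_mul]
  change (∫⁻ x, ∫⁻ y, F1 x y) + (∫⁻ x, ∫⁻ y, F2 x y) +
    ENNReal.ofReal (2 * P) * (∫⁻ x, ∫⁻ y, G x y) ≤ ∫⁻ x, ∫⁻ y,
      ENNReal.ofReal ((u x + v x) ^ P) * ENNReal.ofReal ((u y + v y) ^ P) * K x y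
  rw [h2P, ← add_assoc, hadd F1 F2 m1, hadd (fun x y => F1 x y + F2 x y) _ (m1.add m2),
    hadd (fun x y => F1 x y + F2 x y + ENNReal.ofReal P * G x y) _
      ((m1.add m2).add (mG.const_mul _))]
  refine lintegral_mono fun x => lintegral_mono fun y => ?_
  have hp := choq_ptwise (hu0 x) (hv0 x) (hu0 y) (hv0 y) hP
  have ux := hu0 x
  have uy := hu0 y
  have vx := hv0 x
  have vy := hv0 y
  have hP0 : 0 ≤ P := by linarith
  simp only [hF1, hF2, hG, hKs y x]
  calc _ = ENNReal.ofReal (u x ^ P * u y ^ P + v x ^ P * v y ^ P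
        + P * (u x ^ (P - 1) * v x * u y ^ P) + P * (u y ^ (P - 1) * v y * u x ^ P)) * K x y := by
        rw [ENNReal.ofReal_add (by positivity) (by positivity),
          ENNReal.ofReal_add (by positivity) (by positivity),
          ENNReal.ofReal_add (by positivity) (by positivity),
          ENNReal.ofReal_mul (p := u x ^ P) (by positivity),
          ENNReal.ofReal_mul (p := v x ^ P) (by positivity),
          ENNReal.ofReal_mul (p := P) (by positivity),
          ENNReal.ofReal_mul (p := P) (by positivity),
          ENNReal.ofReal_mul (p := u x ^ (P - 1) * v x) (by positivity),
          ENNReal.ofReal_mul (p := u y ^ (P - 1) * v y) (by positivity)]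
        ring
    _ ≤ ENNReal.ofReal ((u x + v x) ^ P * (u y + v y) ^ P) * K x y := by
        gcongr
    _ = _ := by rw [ENNReal.ofReal_mul (by positivity)]
end
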